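/- Let Ω ⊆ ℝ² be open and connected, let T = (x̃, ỹ) : Ω → ℝ² be differentiable, let h : Ω → ℝ and h̃ : ℝ² → ℝ be differentiable, and define S(x,y) = √((x̃(x,y) − x)² + (ỹ(x,y) − y)² + (h̃(T(x,y)) − h(x,y))²). Assume for every (x,y) ∈ Ω: S(x,y) > 0, S(x,y) + h̃(T(x,y)) − h(x,y) ≠ 0, h_x(x,y) = (x − x̃(x,y))/(S(x,y) + h̃(T(x,y)) − h(x,y)), h_y(x,y) = (y − ỹ(x,y))/(S(x,y) + h̃(T(x,y)) − h(x,y)), h̃_x̃(T(x,y)) = h_x(x,y) and h̃_ỹ(T(x,y)) = h_y(x,y). Then there exists a constant P₀ ≠ 0 such that for all (x,y) ∈ Ω: h_x(x,y) = (x − x̃(x,y))/P₀, h_y(x,y) = (y − ỹ(x,y))/P₀, h̃_x̃(T(x,y)) = (x − x̃(x,y))/P₀, and h̃_ỹ(T(x,y)) = (y − ỹ(x,y))/P₀. -/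

import Mathlib

open Set

/-- A linear functional on `ℝ × ℝ` is determined by its values on the two basis vectors. -/
lemma ContinuousLinearMap.apply_prod_eq (L : ℝ × ℝ →L[ℝ] ℝ) (v : ℝ × ℝ) :
    L v = v.1 * L (1, 0) + v.2 * L (0, 1) := by
  have hv : v = v.1 • ((1, 0) : ℝ × ℝ) + v.2 • ((0, 1) : ℝ × ℝ) := by
    ext <;> simp
  conv_lhs => rw [hv]
  rw [map_add, map_smul, map_smul, smul_eq_mul, smul_eq_mul]

/-- Under the law of reflection, the optical path length has vanishing derivative. -/
lemma hasFDerivAt_opticalPath_zero {T : ℝ × ℝ → ℝ × ℝ} {h ht S : ℝ × ℝ → ℝ} {p : ℝ × ℝ}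
    (hT : DifferentiableAt ℝ T p) (hh : DifferentiableAt ℝ h p)
    (hht : DifferentiableAt ℝ ht (T p))
    (hSdef : ∀ p, S p =
      Real.sqrt (((T p).1 - p.1) ^ 2 + ((T p).2 - p.2) ^ 2 + (ht (T p) - h p) ^ 2))
    (hSpos : 0 < S p) (hP : S p + ht (T p) - h p ≠ 0)
    (hhx : fderiv ℝ h p (1, 0) = (p.1 - (T p).1) / (S p + ht (T p) - h p))
    (hhy : fderiv ℝ h p (0, 1) = (p.2 - (T p).2) / (S p + ht (T p) - h p))
    (hhtx : fderiv ℝ ht (T p) (1, 0) = fderiv ℝ h p (1, 0))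
    (hhty : fderiv ℝ ht (T p) (0, 1) = fderiv ℝ h p (0, 1)) :
    HasFDerivAt (fun q => S q + ht (T q) - h q) (0 : ℝ × ℝ →L[ℝ] ℝ) p := by
  have hu := hT.hasFDerivAt.fst.sub (hasFDerivAt_fst (𝕜 := ℝ) (p := p))
  have hw := hT.hasFDerivAt.snd.sub (hasFDerivAt_snd (𝕜 := ℝ) (p := p))
  have hcomp := hht.hasFDerivAt.comp p hT.hasFDerivAt
  have hg := hcomp.sub hh.hasFDerivAt
  have hne : ((T p).1 - p.1) ^ 2 + ((T p).2 - p.2) ^ 2 + (ht (T p) - h p) ^ 2 ≠ 0 := by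
    intro h0
    rw [hSdef p, h0, Real.sqrt_zero] at hSpos
    exact lt_irrefl _ hSpos
  have hS := (((hu.pow 2).add (hw.pow 2)).add (hg.pow 2)).sqrt hne
  have hS' : HasFDerivAt S _ p := hS.congr_of_eventuallyEq (.of_forall hSdef)
  refine ((hS'.add hcomp).sub hh.hasFDerivAt).congr_fderiv ?_
  refine ContinuousLinearMap.ext fun v => ?_
  have hdh := (fderiv ℝ h p).apply_prod_eq v
  have hdht := (fderiv ℝ ht (T p)).apply_prod_eq (fderiv ℝ T p v)
  rw [hhtx, hhty, hhx, hhy] at hdht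
  rw [hhx, hhy] at hdh
  simp [hdh, hdht, ← hSdef p]
  field_simp
  ring

/-- Theorem 1: the differential equations for the two mirror shapes
decouple — there is a constant `P₀ ≠ 0` (the optical path length) such that
`h_x = (x - x̃)/P₀`, `h_y = (y - ỹ)/P₀`, `h̃_x̃ = (x - x̃)/P₀`, `h̃_ỹ = (y - ỹ)/P₀`
on the open connected set Ω.  Here `T = (x̃, ỹ)` is the ray mapping, `h` the first
mirror surface, `ht` (= h̃) the second, and `S` the distance between corresponding
mirror points. -/
theorem stmt2 (Ω : Set (ℝ × ℝ)) (hΩ : IsOpen Ω) (hΩconn : IsConnected Ω)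
    (T : ℝ × ℝ → ℝ × ℝ) (h : ℝ × ℝ → ℝ) (ht : ℝ × ℝ → ℝ)
    (hTdiff : ∀ p ∈ Ω, DifferentiableAt ℝ T p)
    (hhdiff : ∀ p ∈ Ω, DifferentiableAt ℝ h p)
    (hhtdiff : Differentiable ℝ ht)
    (S : ℝ × ℝ → ℝ)
    (hSdef : ∀ p, S p =
      Real.sqrt (((T p).1 - p.1) ^ 2 + ((T p).2 - p.2) ^ 2 + (ht (T p) - h p) ^ 2))
    (hSpos : ∀ p ∈ Ω, 0 < S p)
    (hPne : ∀ p ∈ Ω, S p + ht (T p) - h p ≠ 0)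
    (hhx : ∀ p ∈ Ω, fderiv ℝ h p (1, 0) = (p.1 - (T p).1) / (S p + ht (T p) - h p))
    (hhy : ∀ p ∈ Ω, fderiv ℝ h p (0, 1) = (p.2 - (T p).2) / (S p + ht (T p) - h p))
    (hhtx : ∀ p ∈ Ω, fderiv ℝ ht (T p) (1, 0) = fderiv ℝ h p (1, 0))
    (hhty : ∀ p ∈ Ω, fderiv ℝ ht (T p) (0, 1) = fderiv ℝ h p (0, 1)) :
    ∃ P₀ : ℝ, P₀ ≠ 0 ∧ ∀ p ∈ Ω,
      fderiv ℝ h p (1, 0) = (p.1 - (T p).1) / P₀ ∧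
      fderiv ℝ h p (0, 1) = (p.2 - (T p).2) / P₀ ∧
      fderiv ℝ ht (T p) (1, 0) = (p.1 - (T p).1) / P₀ ∧
      fderiv ℝ ht (T p) (0, 1) = (p.2 - (T p).2) / P₀ := by
  have hderiv : ∀ p ∈ Ω, HasFDerivAt (fun q => S q + ht (T q) - h q) 0 p := fun p hp =>
    hasFDerivAt_opticalPath_zero (hTdiff p hp) (hhdiff p hp) (hhtdiff (T p)) hSdef
      (hSpos p hp) (hPne p hp) (hhx p hp) (hhy p hp) (hhtx p hp) (hhty p hp)
  obtain ⟨P₀, hP₀⟩ := hΩ.exists_is_const_of_fderiv_eq_zero hΩconn.isPreconnected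
    (f := fun q => S q + ht (T q) - h q) (𝕜 := ℝ)
    (fun p hp => (hderiv p hp).differentiableAt.differentiableWithinAt)
    (fun p hp => (hderiv p hp).fderiv)
  obtain ⟨p₀, hp₀⟩ := hΩconn.nonempty
  refine ⟨P₀, hP₀ p₀ hp₀ ▸ hPne p₀ hp₀, fun p hp => ?_⟩
  have hx := hhx p hp
  have hy := hhy p hp
  rw [hP₀ p hp] at hx hy
  exact ⟨hx, hy, (hhtx p hp).trans hx, (hhty p hp).trans hy⟩
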